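/- Let G be a commutative group, Ĝ := G ⋊ C₂ with γ acting by inversion, and 𝕋̂ := Circle ⋊ C₂ with γ acting by inversion. For w ∈ Circle define χ_w : Ĝ → 𝕋̂ by χ_w(a,1) := (1,1) and χ_w(a,γ) := (w,γ). Then: (i) each χ_w is a group homomorphism over C₂; (ii) a group homomorphism f : Ĝ → 𝕋̂ over C₂ satisfies f(a,1) = (1,1) for all a ∈ G if and only if f = χ_w for a unique w ∈ Circle; (iii) for w, v ∈ Circle, the pointwise product x ↦ ((χ_w)₁(x)·(χ_v)₁(x), π(x)) equals χ_{w·v}. In particular the Real characters of Ĝ restricting trivially to G form a group isomorphic to Circle. -/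

import Mathlib

/-- The cyclic group of order 2, written multiplicatively. -/
abbrev C₂ : Type := Multiplicative (ZMod 2)

/-- The nontrivial element of `C₂`. -/
def γ : C₂ := Multiplicative.ofAdd 1

/-- The action of `C₂` on a commutative group `A` where `γ` acts by inversion. -/
def invHom (A : Type*) [CommGroup A] : C₂ →* MulAut A where
  toFun ε := if ε = 1 then 1 else MulEquiv.inv A
  map_one' := if_pos rfl
  map_mul' x y := by
    have h : ∀ ε : C₂, ε = 1 ∨ ε = γ := by decide
    have hγ : γ ≠ (1 : C₂) := by decide
    have hγγ : γ * γ = (1 : C₂) := by decide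
    have hsq : (MulEquiv.inv A) * (MulEquiv.inv A) = 1 := by
      ext a; simp
    rcases h x with hx | hx <;> rcases h y with hy | hy <;> subst hx <;> subst hy <;>
      simp [hγ, hγγ, hsq]

theorem c2_cases : ∀ ε : C₂, ε = 1 ∨ ε = γ := by decide

theorem gam_ne : γ ≠ (1 : C₂) := by decide

theorem gam_sq : γ * γ = (1 : C₂) := by decide

theorem invHom_gam (A : Type*) [CommGroup A] (a : A) : invHom A γ a = a⁻¹ := by
  simp [invHom, gam_ne]

/-- The character `χ_w`. -/
noncomputable def chiHom (G : Type*) [CommGroup G] (w : Circle) :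
    (G ⋊[invHom G] C₂) →* (Circle ⋊[invHom Circle] C₂) where
  toFun x := ⟨if x.right = 1 then 1 else w, x.right⟩
  map_one' := by ext <;> simp
  map_mul' x y := by
    rcases x with ⟨a, x⟩
    rcases y with ⟨b, y⟩
    rcases c2_cases x with hx | hx <;> rcases c2_cases y with hy | hy <;> subst hx <;> subst hy <;>
      refine SemidirectProduct.ext ?_ ?_ <;>
      simp [gam_ne, gam_sq, invHom_gam]

/-- For `w ∈ Circle` define `χ_w : Ĝ → 𝕋̂` by `χ_w (a,1) = (1,1)` and
`χ_w (a,γ) = (w,γ)`.  Then (i) each `χ_w` is a group homomorphism over `C₂`;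
(ii) a homomorphism `f` over `C₂` restricts trivially to `G` iff `f = χ_w` for a unique
`w`; (iii) the pointwise product of `χ_w` and `χ_v` is `χ_{w·v}`.  In particular the
Real characters restricting trivially to `G` form a group isomorphic to `Circle`. -/
theorem statement5 {G : Type*} [CommGroup G] :
    ∃ χ : Circle → ((G ⋊[invHom G] C₂) →* (Circle ⋊[invHom Circle] C₂)),
      -- the defining formulas for `χ_w`
      (∀ (w : Circle) (a : G), χ w ⟨a, 1⟩ = ⟨1, 1⟩ ∧ χ w ⟨a, γ⟩ = ⟨w, γ⟩) ∧
      -- (i) each `χ_w` is a homomorphism over `C₂`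
      (∀ (w : Circle) (x : G ⋊[invHom G] C₂), (χ w x).right = x.right) ∧
      -- (ii) the homomorphisms over `C₂` restricting trivially to `G` are exactly the
      -- `χ_w` for a unique `w`
      (∀ f : (G ⋊[invHom G] C₂) →* (Circle ⋊[invHom Circle] C₂),
        (∀ x : G ⋊[invHom G] C₂, (f x).right = x.right) →
        ((∀ a : G, f ⟨a, 1⟩ = ⟨1, 1⟩) ↔ ∃! w : Circle, f = χ w)) ∧
      -- (iii) pointwise products correspond to multiplication in `Circle`
      (∀ (w v : Circle) (x : G ⋊[invHom G] C₂),
        χ (w * v) x = ⟨(χ w x).left * (χ v x).left, x.right⟩) := by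
  refine ⟨chiHom G, ?_, ?_, ?_, ?_⟩
  · intro w a
    constructor
    · simp [chiHom]
    · simp [chiHom, gam_ne]
  · intro w x
    rfl
  · intro f hf
    constructor
    · intro h
      refine ⟨(f ⟨1, γ⟩).left, ?_, ?_⟩
      · refine MonoidHom.ext ?_
        rintro ⟨a, x⟩
        rcases c2_cases x with hx | hx <;> subst hx
        · rw [h a]
          simp [chiHom]
        · have e : (⟨a, γ⟩ : G ⋊[invHom G] C₂) = ⟨a, 1⟩ * ⟨1, γ⟩ := by
            refine SemidirectProduct.ext ?_ ?_ <;> simp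
          have e2 : f ⟨a, γ⟩ = f ⟨1, γ⟩ := by
            rw [e, map_mul, h a]
            exact one_mul _
          rw [e2]
          refine SemidirectProduct.ext ?_ ?_
          · simp [chiHom, gam_ne]
          · rw [hf]
            rfl
      · intro w hw
        rw [hw]
        simp [chiHom, gam_ne]
    · rintro ⟨w, hw, -⟩ a
      have hw' : f = chiHom G w := hw
      rw [hw']
      simp [chiHom]
  · rintro w v ⟨a, x⟩
    rcases c2_cases x with hx | hx <;> subst hx <;>
      refine SemidirectProduct.ext ?_ ?_ <;> simp [chiHom, gam_ne]
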